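/- There does not exist a strongly regular graph with parameters (1911, 270, 105, 27); that is, there is no simple graph on 1911 vertices that is 270-regular, in which any two adjacent vertices have exactly 105 common neighbours and any two distinct non-adjacent vertices have exactly 27 common neighbours. -/

import Mathlib

section

open Finset
open scoped InnerProductSpace Matrix

set_option linter.unusedSectionVars false

variable {V : Type*} {G : SimpleGraph V} [DecidableRel G.Adj]

/-- The real-valued adjacency function. -/
def adjReal (G : SimpleGraph V) [DecidableRel G.Adj] (u v : V) : ℝ := if G.Adj u v then 1 else 0

lemma adjReal_comm (u v : V) : adjReal G u v = adjReal G v u := by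
  simp [adjReal, G.adj_comm]

lemma adjReal_self (u : V) : adjReal G u u = 0 := by simp [adjReal]

lemma adjReal_eq_zero_or_one (u v : V) : adjReal G u v = 0 ∨ adjReal G u v = 1 := by
  unfold adjReal; split_ifs <;> simp

variable [Fintype V]

lemma sum_adjReal (h : G.IsSRGWith 1911 270 105 27) (u : V) : ∑ v, adjReal G u v = 270 := by
  have := h.regular u
  simp only [adjReal, sum_boole]
  rw [← G.neighborFinset_eq_filter, G.card_neighborFinset_eq_degree, this]
  norm_num

variable [DecidableEq V]

lemma sum_adjReal_mul (h : G.IsSRGWith 1911 270 105 27) (u v : V) :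
    ∑ w, adjReal G u w * adjReal G w v =
      if u = v then 270 else if G.Adj u v then 105 else 27 := by
  have := congrFun (congrFun (h.matrix_eq (α := ℝ)) u) v
  rw [sq, Matrix.mul_apply] at this
  simp only [SimpleGraph.adjMatrix_apply, Matrix.add_apply, Matrix.smul_apply, Matrix.one_apply,
    SimpleGraph.compl_adj] at this
  unfold adjReal
  rw [this]
  by_cases huv : u = v
  · subst huv; simp
  · by_cases ha : G.Adj u v <;> simp [huv, ha]

/-- A Gram representation of the matrix `A + 3 I - J / 7`. -/
lemma exists_gram_sub (h : G.IsSRGWith 1911 270 105 27) :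
    ∃ β : V → EuclideanSpace ℝ V, ∀ u v,
      ⟪β u, β v⟫_ℝ = adjReal G u v + (if u = v then 3 else 0) - 1 / 7 := by
  refine ⟨fun u => (√84)⁻¹ • WithLp.toLp 2
    (fun z => adjReal G u z + (if z = u then 3 else 0) - 1 / 7), fun u v => ?_⟩
  have h1 : ∑ z, (adjReal G u z + (if z = u then 3 else 0) - 1 / 7) *
      (adjReal G v z + (if z = v then 3 else 0) - 1 / 7) =
      84 * (adjReal G u v + (if u = v then 3 else 0) - 1 / 7) := by
    have e : ∀ z, (adjReal G u z + (if z = u then 3 else 0) - 1 / 7) *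
      (adjReal G v z + (if z = v then 3 else 0) - 1 / 7) =
      adjReal G u z * adjReal G z v + (if z = v then 3 * adjReal G u z else 0)
       + (if z = u then 3 * adjReal G v z + (if z = v then 9 else 0) else 0)
       - 1 / 7 * adjReal G u z - 1 / 7 * adjReal G v z - (if z = u then 3 / 7 else 0)
       - (if z = v then 3 / 7 else 0) + 1 / 49 := by
      intro z
      rw [adjReal_comm z v]
      split_ifs <;> ring
    simp only [e, sum_add_distrib, sum_sub_distrib, ← mul_sum, sum_adjReal h, sum_adjReal_mul h,
      sum_ite_eq', mem_univ, if_true, sum_const, card_univ, h.card, nsmul_eq_mul]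
    rw [adjReal_comm v u]
    unfold adjReal
    by_cases huv : u = v
    · subst huv; norm_num
    · by_cases ha : G.Adj u v <;> simp [huv, ha] <;> norm_num
  rw [real_inner_smul_left, real_inner_smul_right, EuclideanSpace.inner_eq_star_dotProduct]
  simp only [dotProduct, star_trivial]
  rw [← mul_assoc, ← mul_inv, Real.mul_self_sqrt (by norm_num)]
  rw [← mul_right_inj' (show (84 : ℝ) ≠ 0 by norm_num), ← h1, ← mul_assoc,
    mul_inv_cancel₀ (by norm_num), one_mul]
  exact sum_congr rfl fun z _ => mul_comm _ _

/-- A Gram representation of the matrix `A + 3 I`. -/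
lemma exists_gram (h : G.IsSRGWith 1911 270 105 27) :
    ∃ κ : V → WithLp 2 (EuclideanSpace ℝ V × ℝ), ∀ u v,
      ⟪κ u, κ v⟫_ℝ = adjReal G u v + (if u = v then 3 else 0) := by
  obtain ⟨β, hβ⟩ := exists_gram_sub h
  refine ⟨fun u => WithLp.toLp 2 (β u, (√7)⁻¹), fun u v => ?_⟩
  have : (√7)⁻¹ * (√7)⁻¹ = (1 / 7 : ℝ) := by
    rw [← mul_inv, Real.mul_self_sqrt (by norm_num)]; norm_num
  simp only [WithLp.prod_inner_apply, hβ]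
  rw [real_inner_comm]
  simp only [RCLike.inner_apply, conj_trivial, this]
  ring

/-- A vertex outside a large clique is adjacent to few or to almost all of its members. -/
lemma card_adj_mul_le (h : G.IsSRGWith 1911 270 105 27) {S : Finset V}
    (hS : G.IsClique (S : Set V)) {z : V} (hz : z ∉ S) :
    7 * (#{v ∈ S | G.Adj z v} * #{v ∈ S | ¬ G.Adj z v}) ≤ 40 * #S := by
  obtain ⟨β, hβ⟩ := exists_gram_sub h
  set d := #{v ∈ S | G.Adj z v} with hd
  set e := #{v ∈ S | ¬ G.Adj z v} with he
  have hc : d + e = #S := card_filter_add_card_filter_not (s := S) (fun v => G.Adj z v)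
  let g : V → ℝ := fun v => if G.Adj z v then e else -d
  have hg : ∑ v ∈ S, g v = 0 := by
    simp only [g, sum_ite, sum_const, nsmul_eq_mul, ← hd, ← he]; ring
  have hg2 : ∑ v ∈ S, g v * g v = d * e * (d + e) := by
    simp only [g, ← pow_two, ite_pow, sum_ite, sum_const, nsmul_eq_mul, ← hd, ← he]; ring
  have hgz : ∑ v ∈ S, g v * adjReal G z v = d * e := by
    simp only [g, adjReal, mul_ite, mul_one, mul_zero, sum_ite, sum_const_zero, add_zero]
    simp [filter_filter, ← hd]
  have h1 : ⟪β z, ∑ v ∈ S, g v • β v⟫_ℝ = d * e := by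
    simp only [inner_sum, real_inner_smul_right, hβ]
    have : ∀ v ∈ S, g v * (adjReal G z v + (if z = v then 3 else 0) - 1 / 7) =
        g v * adjReal G z v - 1 / 7 * g v := by
      intro v hv
      rw [if_neg (by rintro rfl; exact hz hv)]; ring
    rw [sum_congr rfl this, sum_sub_distrib, ← mul_sum, hg, hgz]; ring
  have h2 : ⟪∑ v ∈ S, g v • β v, ∑ v ∈ S, g v • β v⟫_ℝ = 2 * (d * e * (d + e)) := by
    simp only [inner_sum, sum_inner, real_inner_smul_left, real_inner_smul_right, hβ]
    rw [← hg2, mul_sum]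
    refine sum_congr rfl fun u hu => ?_
    have : ∀ v ∈ S, g u * (g v * (adjReal G v u + (if v = u then 3 else 0) - 1 / 7)) =
        6 / 7 * g u * g v + (if v = u then 2 * (g u * g v) else 0) := by
      intro v hv
      by_cases huv : v = u
      · subst huv; rw [adjReal_self]; simp; ring
      · have : adjReal G v u = 1 := by simp [adjReal, hS hv hu huv]
        rw [this]; simp [huv]; ring
    rw [sum_congr rfl this, sum_add_distrib, ← mul_sum, hg, sum_ite_eq', if_pos hu]
    ring
  have h3 := real_inner_mul_inner_self_le (β z) (∑ v ∈ S, g v • β v)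
  rw [h1, h2, hβ, adjReal_self, if_pos rfl] at h3
  rw [← hc]
  have h4 : 7 * ((d : ℝ) * e) ≤ 40 * (d + e) := by
    rcases (Nat.zero_le (d * e)).eq_or_lt with h0 | h0
    · have : (d : ℝ) * e = 0 := by exact_mod_cast h0.symm
      rw [this, mul_zero]; positivity
    · have : (0 : ℝ) < (d : ℝ) * e := by exact_mod_cast h0
      by_contra hlt
      nlinarith
  exact_mod_cast h4

/-- The counting behind the Delsarte bound. -/
lemma sum_compl_clique (h : G.IsSRGWith 1911 270 105 27) {S : Finset V}
    (hS : G.IsClique (S : Set V)) :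
    ∑ z ∈ Sᶜ, ((#{v ∈ S | G.Adj z v} : ℝ) - 9) ^ 2 =
      (91 - #S) * ((#S : ℝ) ^ 2 - 34 * #S + 1701) := by
  have hd : ∀ z, (#{v ∈ S | G.Adj z v} : ℝ) = ∑ v ∈ S, adjReal G z v := by
    intro z; simp [adjReal]
  simp only [hd]
  have h1 : ∑ z, ∑ v ∈ S, adjReal G z v = 270 * #S := by
    rw [sum_comm, sum_congr rfl fun v _ => (sum_congr rfl fun z _ => adjReal_comm z v).trans
      (sum_adjReal h v)]
    simp; ring
  have hin : ∀ z ∈ S, ∑ v ∈ S, adjReal G z v = #S - 1 := by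
    intro z hz
    have : ∀ v ∈ S, adjReal G z v = 1 - if z = v then 1 else 0 := by
      intro v hv
      by_cases hzv : z = v
      · subst hzv; simp [adjReal_self]
      · simp [adjReal, hS hz hv hzv, hzv]
    rw [sum_congr rfl this]
    simp [hz]
  have h2 : ∑ z, (∑ v ∈ S, adjReal G z v) ^ 2 = 270 * #S + 105 * (#S * (#S - 1)) := by
    simp only [sq, sum_mul_sum]
    rw [sum_comm]
    have : ∀ u ∈ S, ∑ z, ∑ v ∈ S, adjReal G z u * adjReal G z v = 270 + 105 * (#S - 1) := by
      intro u hu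
      rw [sum_comm]
      have : ∀ v ∈ S, ∑ z, adjReal G z u * adjReal G z v =
          105 * adjReal G u v + if u = v then 270 else 0 := by
        intro v hv
        rw [sum_congr rfl fun z _ => by rw [adjReal_comm z u], sum_adjReal_mul h]
        by_cases huv : u = v
        · subst huv; simp [adjReal_self]
        · simp [adjReal, hS hu hv huv, huv]
      rw [sum_congr rfl this, sum_add_distrib, ← mul_sum, hin u hu, sum_ite_eq, if_pos hu]
      ring
    rw [sum_congr rfl this]; simp; ring
  have h3 : ∑ z ∈ S, (∑ v ∈ S, adjReal G z v - 9) ^ 2 = #S * ((#S : ℝ) - 10) ^ 2 := by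
    rw [sum_congr rfl fun z hz => by rw [hin z hz], sum_const, nsmul_eq_mul]
    ring
  have h4 : ∑ z, (∑ v ∈ S, adjReal G z v - 9) ^ 2 =
      270 * (#S : ℝ) + 105 * (#S * (#S - 1)) - 18 * (270 * #S) + 81 * 1911 := by
    rw [← h2, ← h1, mul_sum, ← sum_sub_distrib]
    have : (81 * 1911 : ℝ) = ∑ z : V, 81 := by simp [h.card]; norm_num
    rw [this, ← sum_add_distrib]
    exact sum_congr rfl fun z _ => by ring
  have h5 := sum_add_sum_compl S fun z => (∑ v ∈ S, adjReal G z v - 9) ^ 2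
  rw [h3, h4] at h5
  linear_combination h5

lemma card_clique_le (h : G.IsSRGWith 1911 270 105 27) {S : Finset V}
    (hS : G.IsClique (S : Set V)) : #S ≤ 91 := by
  have h1 := sum_compl_clique h hS
  have h2 : 0 ≤ ∑ z ∈ Sᶜ, ((#{v ∈ S | G.Adj z v} : ℝ) - 9) ^ 2 := by positivity
  rw [h1] at h2
  by_contra hlt
  have : (91 : ℝ) < #S := by exact_mod_cast not_le.mp hlt
  nlinarith [sq_nonneg ((#S : ℝ) - 17)]

lemma card_adj_of_card_eq (h : G.IsSRGWith 1911 270 105 27) {S : Finset V}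
    (hS : G.IsClique (S : Set V)) (hc : #S = 91) {z : V} (hz : z ∉ S) :
    #{v ∈ S | G.Adj z v} = 9 := by
  have h1 := sum_compl_clique h hS
  rw [hc] at h1
  norm_num at h1
  rw [sum_eq_zero_iff_of_nonneg (fun _ _ => by positivity)] at h1
  have := h1 z (by simpa using hz)
  have : (#{v ∈ S | G.Adj z v} : ℝ) = 9 := by nlinarith
  exact_mod_cast this

/-- The neighbours `p, q, r, t` of `x` are distinct and pairwise nonadjacent. -/
structure IsClaw (G : SimpleGraph V) (x p q r t : V) : Prop where
  xp : G.Adj x p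
  xq : G.Adj x q
  xr : G.Adj x r
  xt : G.Adj x t
  pq : p ≠ q ∧ ¬ G.Adj p q
  pr : p ≠ r ∧ ¬ G.Adj p r
  pt : p ≠ t ∧ ¬ G.Adj p t
  qr : q ≠ r ∧ ¬ G.Adj q r
  qt : q ≠ t ∧ ¬ G.Adj q t
  rt : r ≠ t ∧ ¬ G.Adj r t

lemma IsClaw.swap {x p q r t : V} (c : IsClaw G x p q r t) : IsClaw G x q p r t :=
  ⟨c.xq, c.xp, c.xr, c.xt, ⟨c.pq.1.symm, fun h => c.pq.2 h.symm⟩, c.qr, c.qt, c.pr, c.pt, c.rt⟩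

lemma IsClaw.rotate {x p q r t : V} (c : IsClaw G x p q r t) : IsClaw G x q r t p :=
  ⟨c.xq, c.xr, c.xt, c.xp, c.qr, c.qt, ⟨c.pq.1.symm, fun h => c.pq.2 h.symm⟩, c.rt,
    ⟨c.pr.1.symm, fun h => c.pr.2 h.symm⟩, ⟨c.pt.1.symm, fun h => c.pt.2 h.symm⟩⟩

/-- The number of neighbours of `v` among `p, q, r, t`. -/
def leafDegree (G : SimpleGraph V) [DecidableRel G.Adj] (p q r t v : V) : ℝ :=
  adjReal G p v + adjReal G q v + adjReal G r v + adjReal G t v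

/-- The number of common neighbours of `u` and `v` among `p, q, r, t`. -/
def leafCommon (G : SimpleGraph V) [DecidableRel G.Adj] (p q r t u v : V) : ℝ :=
  adjReal G p u * adjReal G p v + adjReal G q u * adjReal G q v +
    adjReal G r u * adjReal G r v + adjReal G t u * adjReal G t v

/-- The number of common neighbours of `x`, `p` and `q`. -/
def tripleCount (G : SimpleGraph V) [DecidableRel G.Adj] (x p q : V) : ℝ :=
  ∑ v with G.Adj x v, adjReal G p v * adjReal G q v

open Classical in
/-- The neighbours of `x` with one or two neighbours among `p, q, r, t`. -/
noncomputable def clawCore (G : SimpleGraph V) [DecidableRel G.Adj] (x p q r t : V) : Finset V :=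
  {v | G.Adj x v ∧ (leafDegree G p q r t v = 1 ∨ leafDegree G p q r t v = 2)}

/-- The neighbours of `x` other than the leaves `p, q, r, t`. -/
def clawRest (G : SimpleGraph V) [DecidableRel G.Adj] (x p q r t : V) : Finset V :=
  ({v | G.Adj x v} : Finset V) \ {p, q, r, t}

lemma card_nbr (h : G.IsSRGWith 1911 270 105 27) (x : V) : #{v | G.Adj x v} = 270 := by
  rw [← G.neighborFinset_eq_filter, G.card_neighborFinset_eq_degree, h.regular x]

lemma sum_nbr_eq (x : V) (f : V → ℝ) :
    ∑ v with G.Adj x v, f v = ∑ v, adjReal G x v * f v := by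
  simp [adjReal, sum_filter]

lemma sum_nbr_adj (h : G.IsSRGWith 1911 270 105 27) {x p : V} (hxp : G.Adj x p) :
    ∑ v with G.Adj x v, adjReal G p v = 105 := by
  rw [sum_nbr_eq, sum_congr rfl fun v _ => by rw [adjReal_comm p v], sum_adjReal_mul h]
  simp [hxp.ne, hxp]

lemma tripleCount_le (h : G.IsSRGWith 1911 270 105 27) {x p q : V} (hp : G.Adj x p)
    (hq : G.Adj x q) (hpq : p ≠ q ∧ ¬ G.Adj p q) : tripleCount G x p q ≤ 26 := by
  have h1 : ∑ v, adjReal G p v * adjReal G q v = 27 := by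
    rw [sum_congr rfl fun v _ => by rw [adjReal_comm q v], sum_adjReal_mul h]
    simp [hpq]
  have h2 : ∀ v, 0 ≤ adjReal G p v * adjReal G q v := fun v => by
    unfold adjReal; positivity
  have h3 : adjReal G p x * adjReal G q x = 1 := by simp [adjReal, hp.symm, hq.symm]
  have h4 := sum_le_sum_of_subset_of_nonneg (s := insert x ({v | G.Adj x v} : Finset V))
    (subset_univ _) (f := fun v => adjReal G p v * adjReal G q v) fun v _ _ => h2 v
  rw [sum_insert (by simp), h3, h1] at h4
  unfold tripleCount
  linarith

lemma sum_clawRest {x p q r t : V} (c : IsClaw G x p q r t) (f : V → ℝ) :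
    ∑ v ∈ clawRest G x p q r t, f v =
      ∑ v with G.Adj x v, f v - (f p + f q + f r + f t) := by
  have hsub : ({p, q, r, t} : Finset V) ⊆ ({v | G.Adj x v} : Finset V) := by
    intro v
    simp only [mem_insert, mem_singleton, mem_filter, mem_univ, true_and]
    rintro (rfl | rfl | rfl | rfl)
    exacts [c.xp, c.xq, c.xr, c.xt]
  have := sum_sdiff hsub (f := f)
  rw [sum_insert (by simp [c.pq.1, c.pr.1, c.pt.1]), sum_insert (by simp [c.qr.1, c.qt.1]),
    sum_insert (by simp [c.rt.1]), sum_singleton] at this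
  unfold clawRest
  linarith

lemma adjReal_eq_zero {u v : V} (huv : ¬ G.Adj u v) : adjReal G u v = 0 := by simp [adjReal, huv]

lemma adjReal_eq_one {u v : V} (huv : G.Adj u v) : adjReal G u v = 1 := by simp [adjReal, huv]

lemma IsClaw.adj_leaf {x p q r t : V} (c : IsClaw G x p q r t) :
    adjReal G p p = 0 ∧ adjReal G p q = 0 ∧ adjReal G p r = 0 ∧ adjReal G p t = 0 :=
  ⟨adjReal_self p, adjReal_eq_zero c.pq.2, adjReal_eq_zero c.pr.2, adjReal_eq_zero c.pt.2⟩

lemma IsClaw.leafDegree_leaf {x p q r t : V} (c : IsClaw G x p q r t) :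
    leafDegree G p q r t p = 0 ∧ leafDegree G p q r t q = 0 ∧
      leafDegree G p q r t r = 0 ∧ leafDegree G p q r t t = 0 := by
  obtain ⟨h1, h2, h3, h4⟩ := c.adj_leaf
  obtain ⟨h5, h6, h7, h8⟩ := c.rotate.adj_leaf
  obtain ⟨h9, h10, h11, h12⟩ := c.rotate.rotate.adj_leaf
  obtain ⟨h13, h14, h15, h16⟩ := c.rotate.rotate.rotate.adj_leaf
  simp [leafDegree, *]

lemma clawCore_subset {x p q r t : V} (c : IsClaw G x p q r t) :
    clawCore G x p q r t ⊆ clawRest G x p q r t := by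
  obtain ⟨h1, h2, h3, h4⟩ := c.leafDegree_leaf
  intro v hv
  simp only [clawCore, mem_filter, mem_univ, true_and] at hv
  simp only [clawRest, mem_sdiff, mem_filter, mem_univ, true_and, mem_insert, mem_singleton, hv.1]
  rintro (rfl | rfl | rfl | rfl) <;> simp_all

open Classical in
lemma sum_clawCore {x p q r t : V} (c : IsClaw G x p q r t) (f : V → ℝ) :
    ∑ v ∈ clawCore G x p q r t, f v = ∑ v ∈ clawRest G x p q r t,
      if leafDegree G p q r t v = 1 ∨ leafDegree G p q r t v = 2 then f v else 0 := by
  rw [← sum_filter]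
  refine sum_congr ?_ fun _ _ => rfl
  ext v
  constructor
  · intro hv
    refine mem_filter.mpr ⟨clawCore_subset c hv, ?_⟩
    exact (mem_filter.mp hv).2.2
  · intro hv
    simp only [mem_filter, clawRest, mem_sdiff, mem_univ, true_and] at hv
    simp [clawCore, hv.1.1, hv.2]

/-- The weight of a vertex which is not adjacent to exactly one or two leaves. -/
noncomputable def defect (G : SimpleGraph V) [DecidableRel G.Adj] (p q r t v : V) : ℝ :=
  (leafDegree G p q r t v - 1) * (leafDegree G p q r t v - 2) / 2

lemma defect_nonneg (p q r t v : V) : 0 ≤ defect G p q r t v := by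
  unfold defect leafDegree
  rcases adjReal_eq_zero_or_one (G := G) p v with h1 | h1 <;>
  rcases adjReal_eq_zero_or_one (G := G) q v with h2 | h2 <;>
  rcases adjReal_eq_zero_or_one (G := G) r v with h3 | h3 <;>
  rcases adjReal_eq_zero_or_one (G := G) t v with h4 | h4 <;>
  norm_num [h1, h2, h3, h4]

lemma adjReal_mul_self (u v : V) : adjReal G u v * adjReal G u v = adjReal G u v := by
  rcases adjReal_eq_zero_or_one (G := G) u v with h | h <;> simp [h]

lemma sum_defect (h : G.IsSRGWith 1911 270 105 27) {x p q r t : V} (c : IsClaw G x p q r t) :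
    ∑ v ∈ clawRest G x p q r t, defect G p q r t v =
      tripleCount G x p q + tripleCount G x p r + tripleCount G x p t + tripleCount G x q r +
        tripleCount G x q t + tripleCount G x r t - 154 := by
  obtain ⟨h1, h2, h3, h4⟩ := c.leafDegree_leaf
  rw [sum_clawRest c]
  have e : ∀ v, defect G p q r t v = 1 - adjReal G p v - adjReal G q v - adjReal G r v -
      adjReal G t v + adjReal G p v * adjReal G q v + adjReal G p v * adjReal G r v +
      adjReal G p v * adjReal G t v + adjReal G q v * adjReal G r v +
      adjReal G q v * adjReal G t v + adjReal G r v * adjReal G t v := by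
    intro v
    unfold defect leafDegree
    linear_combination (adjReal_mul_self (G := G) p v + adjReal_mul_self (G := G) q v +
      adjReal_mul_self (G := G) r v + adjReal_mul_self (G := G) t v) / 2
  have e2 : ∑ v with G.Adj x v, defect G p q r t v = 270 - 105 - 105 - 105 - 105 +
      tripleCount G x p q + tripleCount G x p r + tripleCount G x p t + tripleCount G x q r +
        tripleCount G x q t + tripleCount G x r t := by
    simp only [e, sum_add_distrib, sum_sub_distrib, sum_nbr_adj h c.xp, sum_nbr_adj h c.xq,
      sum_nbr_adj h c.xr, sum_nbr_adj h c.xt, sum_const, card_nbr h, tripleCount]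
    norm_num
  rw [e2]
  simp only [defect, h1, h2, h3, h4]
  ring

lemma sum_defect_le (h : G.IsSRGWith 1911 270 105 27) {x p q r t : V}
    (c : IsClaw G x p q r t) : ∑ v ∈ clawRest G x p q r t, defect G p q r t v ≤ 2 := by
  rw [sum_defect h c]
  linarith [tripleCount_le h c.xp c.xq c.pq, tripleCount_le h c.xp c.xr c.pr,
    tripleCount_le h c.xp c.xt c.pt, tripleCount_le h c.xq c.xr c.qr,
    tripleCount_le h c.xq c.xt c.qt, tripleCount_le h c.xr c.xt c.rt]

lemma sum_core_private (h : G.IsSRGWith 1911 270 105 27) {x p q r t : V}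
    (c : IsClaw G x p q r t) :
    27 ≤ ∑ v ∈ clawCore G x p q r t, adjReal G p v * (2 - leafDegree G p q r t v) ∧
    ∑ v ∈ clawCore G x p q r t, adjReal G p v * (2 - leafDegree G p q r t v) ≤ 29 := by
  classical
  obtain ⟨h1, h2, h3, h4⟩ := c.adj_leaf
  have e : ∑ v ∈ clawRest G x p q r t, adjReal G p v * (2 - leafDegree G p q r t v) =
      105 - tripleCount G x p q - tripleCount G x p r - tripleCount G x p t := by
    have e : ∀ v, adjReal G p v * (2 - leafDegree G p q r t v) = adjReal G p v -
        adjReal G p v * adjReal G q v - adjReal G p v * adjReal G r v -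
        adjReal G p v * adjReal G t v := by
      intro v
      unfold leafDegree
      linear_combination - adjReal_mul_self (G := G) p v
    rw [sum_clawRest c]
    simp only [e, sum_sub_distrib, sum_nbr_adj h c.xp, h1, h2, h3, h4, tripleCount]
    ring
  have b1 := tripleCount_le h c.xp c.xq c.pq
  have b2 := tripleCount_le h c.xp c.xr c.pr
  have b3 := tripleCount_le h c.xp c.xt c.pt
  have b4 := tripleCount_le h c.xq c.xr c.qr
  have b5 := tripleCount_le h c.xq c.xt c.qt
  have b6 := tripleCount_le h c.xr c.xt c.rt
  have hd := sum_defect h c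
  rw [sum_clawCore c]
  constructor
  · refine le_trans ?_ (sum_le_sum (f := fun v =>
      adjReal G p v * (2 - leafDegree G p q r t v)) fun v _ => ?_)
    · rw [e]; linarith
    · unfold leafDegree
      rcases adjReal_eq_zero_or_one (G := G) p v with h1 | h1 <;>
      rcases adjReal_eq_zero_or_one (G := G) q v with h2 | h2 <;>
      rcases adjReal_eq_zero_or_one (G := G) r v with h3 | h3 <;>
      rcases adjReal_eq_zero_or_one (G := G) t v with h4 | h4 <;>
      norm_num [h1, h2, h3, h4]
  · refine le_trans (sum_le_sum (g := fun v =>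
      adjReal G p v * (2 - leafDegree G p q r t v) + defect G p q r t v) fun v _ => ?_) ?_
    · unfold defect leafDegree
      rcases adjReal_eq_zero_or_one (G := G) p v with h1 | h1 <;>
      rcases adjReal_eq_zero_or_one (G := G) q v with h2 | h2 <;>
      rcases adjReal_eq_zero_or_one (G := G) r v with h3 | h3 <;>
      rcases adjReal_eq_zero_or_one (G := G) t v with h4 | h4 <;>
      norm_num [h1, h2, h3, h4]
    · rw [sum_add_distrib, e, hd]; linarith

lemma le_sum_core_nonadj (h : G.IsSRGWith 1911 270 105 27) {x p q r t : V}
    (c : IsClaw G x p q r t) :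
    72 ≤ ∑ v ∈ clawCore G x p q r t, (1 - adjReal G p v) * (leafDegree G p q r t v - 1) := by
  classical
  obtain ⟨h1, h2, h3, h4⟩ := c.adj_leaf
  obtain ⟨k1, k2, k3, k4⟩ := c.leafDegree_leaf
  have e : ∑ v ∈ clawRest G x p q r t, (1 - adjReal G p v) * (leafDegree G p q r t v - 1) =
      154 - tripleCount G x p q - tripleCount G x p r - tripleCount G x p t := by
    have e : ∀ v, (1 - adjReal G p v) * (leafDegree G p q r t v - 1) = adjReal G p v +
        adjReal G q v + adjReal G r v + adjReal G t v - 1 -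
        adjReal G p v * adjReal G q v - adjReal G p v * adjReal G r v -
        adjReal G p v * adjReal G t v := by
      intro v
      unfold leafDegree
      linear_combination - adjReal_mul_self (G := G) p v
    rw [sum_clawRest c, sum_congr rfl fun v _ => e v]
    simp only [sum_sub_distrib, sum_add_distrib, sum_nbr_adj h c.xp, sum_nbr_adj h c.xq,
      sum_nbr_adj h c.xr, sum_nbr_adj h c.xt, sum_const, card_nbr h, h1, h2, h3, h4, k1, k2, k3,
      k4, tripleCount]
    norm_num
    ring
  have b1 := tripleCount_le h c.xp c.xq c.pq
  have b2 := tripleCount_le h c.xp c.xr c.pr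
  have b3 := tripleCount_le h c.xp c.xt c.pt
  have b4 := tripleCount_le h c.xq c.xr c.qr
  have b5 := tripleCount_le h c.xq c.xt c.qt
  have b6 := tripleCount_le h c.xr c.xt c.rt
  have hd := sum_defect h c
  rw [sum_clawCore c]
  refine le_trans ?_ (sum_le_sum (f := fun v => (1 - adjReal G p v) *
    (leafDegree G p q r t v - 1) - 2 * defect G p q r t v) fun v _ => ?_)
  · rw [sum_sub_distrib, ← mul_sum, e, hd]; linarith
  · unfold defect leafDegree
    rcases adjReal_eq_zero_or_one (G := G) p v with h1 | h1 <;>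
    rcases adjReal_eq_zero_or_one (G := G) q v with h2 | h2 <;>
    rcases adjReal_eq_zero_or_one (G := G) r v with h3 | h3 <;>
    rcases adjReal_eq_zero_or_one (G := G) t v with h4 | h4 <;>
    norm_num [h1, h2, h3, h4]

lemma sum_core_mul_le (h : G.IsSRGWith 1911 270 105 27) {x p q r t : V}
    (c : IsClaw G x p q r t) {a b : V} (ha : G.Adj x a) (hb : G.Adj x b)
    (hab : a ≠ b ∧ ¬ G.Adj a b) :
    ∑ v ∈ clawCore G x p q r t, adjReal G a v * adjReal G b v ≤ 26 := by
  refine le_trans (sum_le_sum_of_subset_of_nonneg ?_ fun v _ _ => ?_) (tripleCount_le h ha hb hab)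
  · exact (clawCore_subset c).trans sdiff_subset
  · unfold adjReal; positivity

lemma le_sum_core_adj (h : G.IsSRGWith 1911 270 105 27) {x p q r t u : V}
    (c : IsClaw G x p q r t) (hu : G.Adj x u) (hdu : leafDegree G p q r t u = 1) :
    102 ≤ ∑ v ∈ clawCore G x p q r t, adjReal G u v := by
  classical
  have hd := sum_defect_le h c
  have e := sum_clawRest c fun v => adjReal G u v
  rw [sum_nbr_adj h hu, adjReal_comm u p, adjReal_comm u q, adjReal_comm u r,
    adjReal_comm u t, ← leafDegree, hdu] at e
  rw [sum_clawCore c]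
  refine le_trans ?_ (sum_le_sum (f := fun v => adjReal G u v - defect G p q r t v) fun v _ => ?_)
  · rw [sum_sub_distrib, e]; linarith
  · unfold defect leafDegree
    rcases adjReal_eq_zero_or_one (G := G) p v with h1 | h1 <;>
    rcases adjReal_eq_zero_or_one (G := G) q v with h2 | h2 <;>
    rcases adjReal_eq_zero_or_one (G := G) r v with h3 | h3 <;>
    rcases adjReal_eq_zero_or_one (G := G) t v with h4 | h4 <;>
    rcases adjReal_eq_zero_or_one (G := G) u v with h5 | h5 <;>
    norm_num [h1, h2, h3, h4, h5]

lemma mem_clawCore {x p q r t v : V} : v ∈ clawCore G x p q r t ↔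
    G.Adj x v ∧ (leafDegree G p q r t v = 1 ∨ leafDegree G p q r t v = 2) := by
  simp [clawCore]

/-- A vertex adjacent to exactly one leaf has few neighbours among the vertices adjacent to two
other leaves, since it can replace that leaf. -/
lemma sum_core_exchange (h : G.IsSRGWith 1911 270 105 27) {x p q r t u : V}
    (c : IsClaw G x p q r t) (hu : G.Adj x u) (hp : adjReal G p u = 1) (hq : adjReal G q u = 0)
    (hr : adjReal G r u = 0) (ht : adjReal G t u = 0) :
    ∑ v ∈ clawCore G x p q r t,
      adjReal G u v * (1 - adjReal G p v) * (leafDegree G p q r t v - 1) ≤ 2 := by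
  have hpu : G.Adj p u := by by_contra hn; simp [adjReal, hn] at hp
  have hqu : ¬ G.Adj q u := by intro hn; simp [adjReal, hn] at hq
  have hru : ¬ G.Adj r u := by intro hn; simp [adjReal, hn] at hr
  have htu : ¬ G.Adj t u := by intro hn; simp [adjReal, hn] at ht
  have c' : IsClaw G x u q r t :=
    ⟨hu, c.xq, c.xr, c.xt, ⟨by rintro rfl; exact c.pq.2 hpu, fun hn => hqu hn.symm⟩,
      ⟨by rintro rfl; exact c.pr.2 hpu, fun hn => hru hn.symm⟩,
      ⟨by rintro rfl; exact c.pt.2 hpu, fun hn => htu hn.symm⟩, c.qr, c.qt, c.rt⟩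
  refine le_trans ?_ (sum_defect_le h c')
  rw [← sum_erase (a := u) _ (by rw [adjReal_self]; ring)]
  refine le_trans (sum_le_sum (g := fun v => defect G u q r t v) fun v hv => ?_)
    (sum_le_sum_of_subset_of_nonneg ?_ fun v _ _ => defect_nonneg _ _ _ _ _)
  · obtain ⟨-, hv⟩ := mem_clawCore.mp (mem_of_mem_erase hv)
    revert hv
    unfold defect leafDegree
    rcases adjReal_eq_zero_or_one (G := G) p v with h1 | h1 <;>
    rcases adjReal_eq_zero_or_one (G := G) q v with h2 | h2 <;>
    rcases adjReal_eq_zero_or_one (G := G) r v with h3 | h3 <;>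
    rcases adjReal_eq_zero_or_one (G := G) t v with h4 | h4 <;>
    rcases adjReal_eq_zero_or_one (G := G) u v with h5 | h5 <;>
    norm_num [h1, h2, h3, h4, h5]
  · intro v hv
    have h1 := clawCore_subset c (mem_of_mem_erase hv)
    have h2 := ne_of_mem_erase hv
    simp only [clawRest, mem_sdiff, mem_filter, mem_univ, true_and, mem_insert, mem_singleton]
      at h1 ⊢
    tauto

/-- The `(u, v)` entry of the matrix which is `15` times the Gram matrix of `A + 3 I` after
projecting off `x, p, q, r, t`. -/
noncomputable def clawResidual (G : SimpleGraph V) [DecidableRel G.Adj] (p q r t u v : V) : ℝ :=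
  15 * (adjReal G u v + if u = v then 3 else 0) - 9 - 5 * leafCommon G p q r t u v +
    3 * (leafDegree G p q r t u + leafDegree G p q r t v) -
    leafDegree G p q r t u * leafDegree G p q r t v

/-- The entries of the positive semidefinite form on the core of a claw. -/
noncomputable def clawForm (G : SimpleGraph V) [DecidableRel G.Adj] (p q r t u v : V) : ℝ :=
  (39 - 23 * leafDegree G p q r t u) / 16 * ((39 - 23 * leafDegree G p q r t v) / 16) *
    (4 * leafCommon G p q r t u v - leafDegree G p q r t u * leafDegree G p q r t v) *
    (clawResidual G p q r t u v ^ 2 + 7 * clawResidual G p q r t u v)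

lemma leafCommon_comm (p q r t u v : V) :
    leafCommon G p q r t u v = leafCommon G p q r t v u := by
  unfold leafCommon; ring

lemma clawResidual_comm (p q r t u v : V) :
    clawResidual G p q r t u v = clawResidual G p q r t v u := by
  unfold clawResidual
  rw [leafCommon_comm, adjReal_comm, if_congr (eq_comm (a := u)) rfl rfl]
  ring

lemma clawForm_comm (p q r t u v : V) :
    clawForm G p q r t u v = clawForm G p q r t v u := by
  unfold clawForm
  rw [leafCommon_comm, clawResidual_comm]
  ring

lemma exists_gram_clawResidual (h : G.IsSRGWith 1911 270 105 27) {x p q r t : V}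
    (c : IsClaw G x p q r t) :
    ∃ ρ : V → WithLp 2 (EuclideanSpace ℝ V × ℝ), ∀ u ∈ clawRest G x p q r t,
      ∀ v ∈ clawRest G x p q r t, 15 * ⟪ρ u, ρ v⟫_ℝ = clawResidual G p q r t u v := by
  obtain ⟨κ, hκ⟩ := exists_gram h
  let b : V → ℝ := fun u => (3 - leafDegree G p q r t u) / 5
  let ρ := fun u => κ u - b u • κ x - ((adjReal G p u - b u) / 3) • κ p -
    ((adjReal G q u - b u) / 3) • κ q - ((adjReal G r u - b u) / 3) • κ r -
    ((adjReal G t u - b u) / 3) • κ t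
  have hx := adjReal_self (G := G) x
  have hxp := adjReal_eq_one c.xp
  have hxq := adjReal_eq_one c.xq
  have hxr := adjReal_eq_one c.xr
  have hxt := adjReal_eq_one c.xt
  have hpx := adjReal_eq_one c.xp.symm
  have hqx := adjReal_eq_one c.xq.symm
  have hrx := adjReal_eq_one c.xr.symm
  have htx := adjReal_eq_one c.xt.symm
  obtain ⟨h1, h2, h3, h4⟩ := c.adj_leaf
  obtain ⟨h5, h6, h7, h8⟩ := c.rotate.adj_leaf
  obtain ⟨h9, h10, h11, h12⟩ := c.rotate.rotate.adj_leaf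
  obtain ⟨h13, h14, h15, h16⟩ := c.rotate.rotate.rotate.adj_leaf
  have hρ : ∀ u ∈ clawRest G x p q r t, ⟪ρ u, κ x⟫_ℝ = 0 ∧ ⟪ρ u, κ p⟫_ℝ = 0 ∧
      ⟪ρ u, κ q⟫_ℝ = 0 ∧ ⟪ρ u, κ r⟫_ℝ = 0 ∧ ⟪ρ u, κ t⟫_ℝ = 0 := by
    intro u hu
    simp only [clawRest, mem_sdiff, mem_filter, mem_univ, true_and, mem_insert, mem_singleton,
      not_or] at hu
    obtain ⟨hxu, hup, huq, hur, hut⟩ := hu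
    have hux := adjReal_eq_one hxu.symm
    simp only [ρ, inner_sub_left, real_inner_smul_left, *, adjReal_comm u, hxu.ne', if_true,
      if_false, c.xp.ne, c.xq.ne, c.xr.ne, c.xt.ne, c.xp.ne', c.xq.ne', c.xr.ne', c.xt.ne',
      c.pq.1, c.pr.1, c.pt.1, c.qr.1, c.qt.1, c.rt.1, c.pq.1.symm, c.pr.1.symm, c.pt.1.symm,
      c.qr.1.symm, c.qt.1.symm, c.rt.1.symm]
    rw [adjReal_eq_one hxu]
    simp only [b, leafDegree]
    refine ⟨?_, ?_, ?_, ?_, ?_⟩ <;> ring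
  refine ⟨ρ, fun u hu v hv => ?_⟩
  obtain ⟨e1, e2, e3, e4, e5⟩ := hρ u hu
  have e : ⟪ρ u, ρ v⟫_ℝ = ⟪ρ u, κ v⟫_ℝ := by
    conv_lhs => rw [show ρ v = κ v - b v • κ x - ((adjReal G p v - b v) / 3) • κ p -
      ((adjReal G q v - b v) / 3) • κ q - ((adjReal G r v - b v) / 3) • κ r -
      ((adjReal G t v - b v) / 3) • κ t from rfl]
    simp only [inner_sub_right, real_inner_smul_right, e1, e2, e3, e4, e5]
    ring
  rw [e]
  simp only [clawRest, mem_sdiff, mem_filter, mem_univ, true_and, mem_insert, mem_singleton,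
    not_or] at hv
  obtain ⟨hxv, hvp, hvq, hvr, hvt⟩ := hv
  simp only [ρ, inner_sub_left, real_inner_smul_left, hκ, adjReal_eq_one hxv, hxv.ne,
    Ne.symm hvp, Ne.symm hvq, Ne.symm hvr, Ne.symm hvt, if_false]
  simp only [b, clawResidual, leafDegree, leafCommon]
  ring

lemma sum_clawForm_nonneg (h : G.IsSRGWith 1911 270 105 27) {x p q r t : V}
    (c : IsClaw G x p q r t) :
    0 ≤ ∑ u ∈ clawCore G x p q r t, ∑ v ∈ clawCore G x p q r t, clawForm G p q r t u v := by
  obtain ⟨ρ, hρ⟩ := exists_gram_clawResidual h c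
  let P : Matrix (clawCore G x p q r t) (clawCore G x p q r t) ℝ :=
    Matrix.gram ℝ fun u => ρ u
  let H : Matrix (clawCore G x p q r t) (clawCore G x p q r t) ℝ :=
    Matrix.gram ℝ fun u => WithLp.toLp 2 fun i : Fin 4 =>
      2 * adjReal G (![p, q, r, t] i) u - leafDegree G p q r t u / 2
  have hP : P.PosSemidef := Matrix.posSemidef_gram ℝ _
  have hH : H.PosSemidef := Matrix.posSemidef_gram ℝ _
  have hM : (H ⊙ ((225 : ℝ) • (P ⊙ P) + (105 : ℝ) • P)).PosSemidef :=
    hH.hadamard (((hP.hadamard hP).smul (by norm_num)).add (hP.smul (by norm_num)))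
  have h1 := hM.dotProduct_mulVec_nonneg
    fun u => (39 - 23 * leafDegree G p q r t u) / 16
  refine h1.trans_eq ?_
  rw [← sum_coe_sort (clawCore G x p q r t), dotProduct]
  refine sum_congr rfl fun u _ => ?_
  rw [Matrix.mulVec, dotProduct, mul_sum, ← sum_coe_sort (clawCore G x p q r t)]
  refine sum_congr rfl fun v _ => ?_
  simp only [Matrix.hadamard_apply, Matrix.add_apply, Matrix.smul_apply, P, H,
    Matrix.gram_apply, clawForm, smul_eq_mul, Pi.star_apply, star_trivial,
    ← hρ u (clawCore_subset c u.2) v (clawCore_subset c v.2)]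
  simp only [EuclideanSpace.inner_eq_star_dotProduct, dotProduct, Fin.sum_univ_four,
    Pi.star_apply, star_trivial, leafCommon, leafDegree]
  simp
  ring

/-- One row of the symmetrised form on the core of a claw. -/
noncomputable def clawRow (G : SimpleGraph V) [DecidableRel G.Adj] (x p q r t u : V) : ℝ :=
  ∑ v ∈ clawCore G x p q r t,
    (1 + leafDegree G p q r t v - leafDegree G p q r t u) * clawForm G p q r t u v

lemma sum_clawRow (x p q r t : V) :
    ∑ u ∈ clawCore G x p q r t, clawRow G x p q r t u =
      ∑ u ∈ clawCore G x p q r t, ∑ v ∈ clawCore G x p q r t, clawForm G p q r t u v := by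
  have e : ∑ u ∈ clawCore G x p q r t, ∑ v ∈ clawCore G x p q r t,
      leafDegree G p q r t v * clawForm G p q r t u v =
      ∑ u ∈ clawCore G x p q r t, ∑ v ∈ clawCore G x p q r t,
      leafDegree G p q r t u * clawForm G p q r t u v := by
    rw [sum_comm]
    exact sum_congr rfl fun u _ => sum_congr rfl fun v _ => by rw [clawForm_comm]
  simp only [clawRow, add_mul, sub_mul, one_mul, sum_add_distrib, sum_sub_distrib, e]
  ring

lemma leafDegree_swap (p q r t v : V) : leafDegree G q p r t v = leafDegree G p q r t v := by
  unfold leafDegree; ring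

lemma leafDegree_rotate (p q r t v : V) : leafDegree G q r t p v = leafDegree G p q r t v := by
  unfold leafDegree; ring

lemma clawCore_swap (x p q r t : V) : clawCore G x q p r t = clawCore G x p q r t := by
  ext; simp only [mem_clawCore, leafDegree_swap]

lemma clawCore_rotate (x p q r t : V) : clawCore G x q r t p = clawCore G x p q r t := by
  ext; simp only [mem_clawCore, leafDegree_rotate]

lemma clawRow_swap (x p q r t u : V) : clawRow G x q p r t u = clawRow G x p q r t u := by
  have e : ∀ v, leafCommon G q p r t u v = leafCommon G p q r t u v := fun v => by
    unfold leafCommon; ring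
  simp only [clawRow, clawCore_swap, clawForm, clawResidual, leafDegree_swap, e]

lemma clawRow_rotate (x p q r t u : V) : clawRow G x q r t p u = clawRow G x p q r t u := by
  have e : ∀ v, leafCommon G q r t p u v = leafCommon G p q r t u v := fun v => by
    unfold leafCommon; ring
  simp only [clawRow, clawCore_rotate, clawForm, clawResidual, leafDegree_rotate, e]

lemma clawRow_le_of_one (h : G.IsSRGWith 1911 270 105 27) {x p q r t u : V}
    (c : IsClaw G x p q r t) (hu : G.Adj x u) (hp : adjReal G p u = 1) (hq : adjReal G q u = 0)
    (hr : adjReal G r u = 0) (ht : adjReal G t u = 0) : clawRow G x p q r t u ≤ -3195 := by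
  have hdu : leafDegree G p q r t u = 1 := by simp [leafDegree, hp, hq, hr, ht]
  have huD : u ∈ clawCore G x p q r t := mem_clawCore.mpr ⟨hu, Or.inl hdu⟩
  have b1 := (sum_core_private h c).2
  have b2 := (sum_core_private h c.rotate).2
  have b3 := (sum_core_private h c.rotate.rotate).2
  have b4 := (sum_core_private h c.rotate.rotate.rotate).2
  simp only [leafDegree_rotate, clawCore_rotate] at b2 b3 b4
  have b5 := le_sum_core_nonadj h c
  have b6 := le_sum_core_adj h c hu hdu
  have b7 := sum_core_exchange h c hu hp hq hr ht
  have key : ∀ v ∈ clawCore G x p q r t,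
      (1 + leafDegree G p q r t v - leafDegree G p q r t u) * clawForm G p q r t u v ≤
      -210 * adjReal G u v + 444 * (adjReal G p v * (2 - leafDegree G p q r t v)) +
      12 * (adjReal G q v * (2 - leafDegree G p q r t v)) +
      12 * (adjReal G r v * (2 - leafDegree G p q r t v)) +
      12 * (adjReal G t v * (2 - leafDegree G p q r t v)) -
      35 / 2 * ((1 - adjReal G p v) * (leafDegree G p q r t v - 1)) +
      1365 / 2 * (adjReal G u v * (1 - adjReal G p v) * (leafDegree G p q r t v - 1)) +
      if u = v then 4200 else 0 := by
    intro v hv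
    by_cases huv : u = v
    · subst huv
      simp only [clawForm, clawResidual, leafCommon, hdu, hp, hq, hr, ht, adjReal_self]
      norm_num
    · obtain ⟨-, hv⟩ := mem_clawCore.mp hv
      simp only [clawForm, clawResidual, leafCommon, hdu, hp, hq, hr, ht, huv, if_false]
      revert hv
      unfold leafDegree
      rcases adjReal_eq_zero_or_one (G := G) p v with h1 | h1 <;>
      rcases adjReal_eq_zero_or_one (G := G) q v with h2 | h2 <;>
      rcases adjReal_eq_zero_or_one (G := G) r v with h3 | h3 <;>
      rcases adjReal_eq_zero_or_one (G := G) t v with h4 | h4 <;>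
      rcases adjReal_eq_zero_or_one (G := G) u v with h5 | h5 <;>
      norm_num [h1, h2, h3, h4, h5]
  refine (sum_le_sum key).trans ?_
  simp only [sum_add_distrib, sum_sub_distrib, ← mul_sum, sum_ite_eq, huD, if_true]
  linarith

lemma clawRow_le_of_two (h : G.IsSRGWith 1911 270 105 27) {x p q r t u : V}
    (c : IsClaw G x p q r t) (hu : G.Adj x u) (hp : adjReal G p u = 1) (hq : adjReal G q u = 1)
    (hr : adjReal G r u = 0) (ht : adjReal G t u = 0) : clawRow G x p q r t u ≤ 2029 := by
  have hdu : leafDegree G p q r t u = 2 := by simp [leafDegree, hp, hq, hr, ht]; norm_num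
  have huD : u ∈ clawCore G x p q r t := mem_clawCore.mpr ⟨hu, Or.inr hdu⟩
  have b1 := sum_core_mul_le h c c.xp c.xq c.pq
  have b2 := sum_core_mul_le h c c.xr c.xt c.rt
  have key : ∀ v ∈ clawCore G x p q r t,
      (1 + leafDegree G p q r t v - leafDegree G p q r t u) * clawForm G p q r t u v ≤
      49 / 256 * 176 * (adjReal G p v * adjReal G q v) +
      49 / 256 * 24 * (adjReal G r v * adjReal G t v) +
      if u = v then 49 / 256 * 5400 else 0 := by
    intro v hv
    by_cases huv : u = v
    · subst huv
      simp only [clawForm, clawResidual, leafCommon, hdu, hp, hq, hr, ht, adjReal_self]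
      norm_num
    · obtain ⟨-, hv⟩ := mem_clawCore.mp hv
      simp only [clawForm, clawResidual, leafCommon, hdu, hp, hq, hr, ht, huv, if_false]
      revert hv
      unfold leafDegree
      rcases adjReal_eq_zero_or_one (G := G) p v with h1 | h1 <;>
      rcases adjReal_eq_zero_or_one (G := G) q v with h2 | h2 <;>
      rcases adjReal_eq_zero_or_one (G := G) r v with h3 | h3 <;>
      rcases adjReal_eq_zero_or_one (G := G) t v with h4 | h4 <;>
      rcases adjReal_eq_zero_or_one (G := G) u v with h5 | h5 <;>
      norm_num [h1, h2, h3, h4, h5]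
  refine (sum_le_sum key).trans ?_
  simp only [sum_add_distrib, ← mul_sum, sum_ite_eq, huD, if_true]
  linarith

lemma not_isClaw (h : G.IsSRGWith 1911 270 105 27) (x p q r t : V) : ¬ IsClaw G x p q r t := by
  intro c
  have b1 := (sum_core_private h c).1
  have b2 := (sum_core_private h c.rotate).1
  have b3 := (sum_core_private h c.rotate.rotate).1
  have b4 := (sum_core_private h c.rotate.rotate.rotate).1
  simp only [leafDegree_rotate, clawCore_rotate] at b2 b3 b4
  have d1 := sum_core_mul_le h c c.xp c.xq c.pq
  have d2 := sum_core_mul_le h c c.xp c.xr c.pr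
  have d3 := sum_core_mul_le h c c.xp c.xt c.pt
  have d4 := sum_core_mul_le h c c.xq c.xr c.qr
  have d5 := sum_core_mul_le h c c.xq c.xt c.qt
  have d6 := sum_core_mul_le h c c.xr c.xt c.rt
  have key : ∀ u ∈ clawCore G x p q r t, clawRow G x p q r t u ≤
      -3195 * (adjReal G p u * (2 - leafDegree G p q r t u)) +
      -3195 * (adjReal G q u * (2 - leafDegree G p q r t u)) +
      -3195 * (adjReal G r u * (2 - leafDegree G p q r t u)) +
      -3195 * (adjReal G t u * (2 - leafDegree G p q r t u)) +
      2029 * (adjReal G p u * adjReal G q u) + 2029 * (adjReal G p u * adjReal G r u) +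
      2029 * (adjReal G p u * adjReal G t u) + 2029 * (adjReal G q u * adjReal G r u) +
      2029 * (adjReal G q u * adjReal G t u) + 2029 * (adjReal G r u * adjReal G t u) := by
    intro u hu
    obtain ⟨hxu, hu⟩ := mem_clawCore.mp hu
    have o1 := clawRow_le_of_one h c hxu
    have o2 := clawRow_le_of_one h c.rotate hxu
    have o3 := clawRow_le_of_one h c.rotate.rotate hxu
    have o4 := clawRow_le_of_one h c.rotate.rotate.rotate hxu
    have t1 := clawRow_le_of_two h c hxu
    have t2 := clawRow_le_of_two h c.rotate hxu
    have t3 := clawRow_le_of_two h c.rotate.rotate hxu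
    have t4 := clawRow_le_of_two h c.rotate.rotate.rotate hxu
    have t5 := clawRow_le_of_two h c.swap.rotate hxu
    have t6 := clawRow_le_of_two h c.rotate.swap.rotate hxu
    have e5 : clawRow G x p r t q u = clawRow G x p q r t u := by
      rw [clawRow_rotate, clawRow_swap]
    have e6 : clawRow G x q t p r u = clawRow G x p q r t u := by
      rw [clawRow_rotate, clawRow_swap, clawRow_rotate]
    simp only [e5, e6, clawRow_rotate] at o2 o3 o4 t2 t3 t4 t5 t6
    revert hu
    unfold leafDegree
    rcases adjReal_eq_zero_or_one (G := G) p u with h1 | h1 <;>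
    rcases adjReal_eq_zero_or_one (G := G) q u with h2 | h2 <;>
    rcases adjReal_eq_zero_or_one (G := G) r u with h3 | h3 <;>
    rcases adjReal_eq_zero_or_one (G := G) t u with h4 | h4 <;>
    simp only [h1, h2, h3, h4, forall_const] at o1 o2 o3 o4 t1 t2 t3 t4 t5 t6 ⊢ <;>
    norm_num <;> linarith
  have h1 := (sum_clawForm_nonneg h c).trans ((sum_clawRow x p q r t).symm.trans_le (sum_le_sum key))
  simp only [sum_add_distrib, ← mul_sum] at h1
  linarith

lemma card_common (h : G.IsSRGWith 1911 270 105 27) (u v : V) :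
    #{w | G.Adj u w ∧ G.Adj v w} = if u = v then 270 else if G.Adj u v then 105 else 27 := by
  have h1 := sum_adjReal_mul h u v
  have h2 : (#{w | G.Adj u w ∧ G.Adj v w} : ℝ) = ∑ w, adjReal G u w * adjReal G w v := by
    simp only [adjReal, G.adj_comm _ v, mul_ite, mul_one, mul_zero, ← ite_and]
    rw [sum_boole]
    simp only [and_comm]
  rw [h1] at h2
  split_ifs at h2 ⊢ <;> exact_mod_cast h2

lemma isClique_insert_nbr {x : V} {Q : Finset V} (hQ : G.IsClique (Q : Set V))
    (hx : ∀ v ∈ Q, G.Adj x v) : G.IsClique ((insert x Q : Finset V) : Set V) := by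
  rw [coe_insert]
  exact hQ.insert fun v hv _ => hx v hv

/-- A large clique in the neighbourhood of `x` is met by each neighbour of `x` in few or in
almost all of its vertices. -/
lemma card_adj_le_or (h : G.IsSRGWith 1911 270 105 27) {x z : V} {Q : Finset V}
    (hQ : G.IsClique (Q : Set V)) (hx : ∀ v ∈ Q, G.Adj x v) (hc : 58 ≤ #Q) (hz : G.Adj x z) :
    #{v ∈ Q | G.Adj z v} ≤ 5 ∨ #{v ∈ Q | ¬ G.Adj z v} ≤ 6 := by
  by_cases hzQ : z ∈ Q
  · right
    refine (card_le_card (t := {z}) fun v hv => ?_).trans (by simp)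
    rw [mem_filter] at hv
    by_contra hne
    exact hv.2 (hQ hzQ hv.1 fun e => hne (by simp [e]))
  · have hxQ : x ∉ Q := fun hxQ => G.loopless.irrefl _ (hx x hxQ)
    have h1 := card_adj_mul_le h (isClique_insert_nbr hQ hx) (z := z)
      (by simp [hz.ne', hzQ])
    rw [filter_insert, filter_insert, if_pos hz.symm, if_neg (not_not.mpr hz.symm),
      card_insert_of_notMem (by simp [hxQ]), card_insert_of_notMem hxQ] at h1
    have h2 := card_filter_add_card_filter_not (s := Q) (fun v => G.Adj z v)
    generalize #{v ∈ Q | G.Adj z v} = d at *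
    generalize #{v ∈ Q | ¬ G.Adj z v} = e at *
    by_contra! hlt
    obtain ⟨h3, h4⟩ := hlt
    obtain ⟨d, rfl⟩ := Nat.exists_eq_add_of_le h3
    obtain ⟨e, rfl⟩ := Nat.exists_eq_add_of_le h4
    nlinarith [Nat.zero_le (d * e)]

/-- Two distinct vertices nonadjacent to few vertices of a large set are adjacent. -/
lemma adj_of_card_nonadj (h : G.IsSRGWith 1911 270 105 27) {z z' : V} {Q : Finset V}
    (hc : 58 ≤ #Q) (hz : #{v ∈ Q | ¬ G.Adj z v} ≤ 6) (hz' : #{v ∈ Q | ¬ G.Adj z' v} ≤ 6)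
    (hne : z ≠ z') : G.Adj z z' := by
  by_contra hn
  have h1 := card_common h z z'
  rw [if_neg hne, if_neg hn] at h1
  have h2 : Q ⊆ ({w | G.Adj z w ∧ G.Adj z' w} : Finset V) ∪
      ({v ∈ Q | ¬ G.Adj z v} ∪ {v ∈ Q | ¬ G.Adj z' v}) := by
    intro v hv
    simp only [mem_union, mem_filter, mem_univ, true_and, hv]
    tauto
  have h3 := (card_le_card h2).trans ((card_union_le _ _).trans
    (Nat.add_le_add_left (card_union_le _ _) _))
  omega

lemma card_adj_le_five (h : G.IsSRGWith 1911 270 105 27) {x z w : V} {Q : Finset V}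
    (hQ : G.IsClique (Q : Set V)) (hx : ∀ v ∈ Q, G.Adj x v) (hc : 58 ≤ #Q) (hz : G.Adj x z)
    (hw : w ∈ Q) (hzw : z ≠ w ∧ ¬ G.Adj z w) : #{v ∈ Q | G.Adj z v} ≤ 5 := by
  refine (card_adj_le_or h hQ hx hc hz).resolve_right fun h1 => hzw.2 ?_
  refine adj_of_card_nonadj h hc h1 ((card_le_card (t := {w}) fun v hv => ?_).trans (by simp))
    hzw.1
  rw [mem_filter] at hv
  by_contra hne
  exact hv.2 (hQ hw hv.1 fun e => hne (by simp [e]))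

/-- The neighbours of `x` different from and nonadjacent to both `p` and `q`. -/
def farNbrs (G : SimpleGraph V) [DecidableRel G.Adj] (x p q : V) : Finset V :=
  {v | G.Adj x v ∧ (p ≠ v ∧ ¬ G.Adj p v) ∧ (q ≠ v ∧ ¬ G.Adj q v)}

lemma mem_farNbrs {x p q v : V} : v ∈ farNbrs G x p q ↔
    G.Adj x v ∧ (p ≠ v ∧ ¬ G.Adj p v) ∧ (q ≠ v ∧ ¬ G.Adj q v) := by
  simp [farNbrs]

lemma le_card_farNbrs (h : G.IsSRGWith 1911 270 105 27) {x p q : V} (hp : G.Adj x p)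
    (hq : G.Adj x q) : 58 ≤ #(farNbrs G x p q) := by
  have h1 : ({v | G.Adj x v} : Finset V) ⊆ farNbrs G x p q ∪
      (({w | G.Adj x w ∧ G.Adj p w} : Finset V) ∪
        (({w | G.Adj x w ∧ G.Adj q w} : Finset V) ∪ {p, q})) := by
    intro v hv
    simp only [mem_filter, mem_univ, true_and] at hv
    simp only [mem_union, mem_farNbrs, mem_filter, mem_univ, true_and, mem_insert,
      mem_singleton, hv, eq_comm (a := v)]
    tauto
  have h2 := (card_le_card h1).trans ((card_union_le _ _).trans (Nat.add_le_add_left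
    ((card_union_le _ _).trans (Nat.add_le_add_left (card_union_le _ _) _)) _))
  rw [card_nbr h, card_common h, card_common h, if_neg hp.ne, if_pos hp, if_neg hq.ne,
    if_pos hq] at h2
  have := card_le_two (a := p) (b := q)
  omega

lemma isClique_farNbrs (h : G.IsSRGWith 1911 270 105 27) {x p q : V} (hp : G.Adj x p)
    (hq : G.Adj x q) (hpq : p ≠ q ∧ ¬ G.Adj p q) : G.IsClique (farNbrs G x p q : Set V) := by
  intro u hu v hv huv
  by_contra hn
  obtain ⟨hxu, hpu, hqu⟩ := mem_farNbrs.mp hu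
  obtain ⟨hxv, hpv, hqv⟩ := mem_farNbrs.mp hv
  exact not_isClaw h x p q u v ⟨hp, hq, hxu, hxv, hpq, hpu, hpv, hqu, hqv, huv, hn⟩

lemma exists_triple (h : G.IsSRGWith 1911 270 105 27) (x : V) :
    ∃ p q r, G.Adj x p ∧ G.Adj x q ∧ G.Adj x r ∧ (p ≠ q ∧ ¬ G.Adj p q) ∧
      (p ≠ r ∧ ¬ G.Adj p r) ∧ (q ≠ r ∧ ¬ G.Adj q r) := by
  obtain ⟨p, hp⟩ : ({v | G.Adj x v} : Finset V).Nonempty := by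
    rw [← card_pos, card_nbr h]; norm_num
  simp only [mem_filter, mem_univ, true_and] at hp
  obtain ⟨q, hq⟩ : (farNbrs G x p p).Nonempty := by
    rw [← card_pos]; have := le_card_farNbrs h hp hp; omega
  obtain ⟨hxq, hpq, -⟩ := mem_farNbrs.mp hq
  obtain ⟨r, hr⟩ : (farNbrs G x p q).Nonempty := by
    rw [← card_pos]; have := le_card_farNbrs h hp hxq; omega
  obtain ⟨hxr, hpr, hqr⟩ := mem_farNbrs.mp hr
  exact ⟨p, q, r, hp, hxq, hxr, hpq, hpr, hqr⟩

/-- The neighbours of `x` which are nonadjacent to at most six vertices of `Q`. -/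
def nearClique (G : SimpleGraph V) [DecidableRel G.Adj] (x : V) (Q : Finset V) : Finset V :=
  {z | G.Adj x z ∧ #{v ∈ Q | ¬ G.Adj z v} ≤ 6}

lemma mem_nearClique {x z : V} {Q : Finset V} :
    z ∈ nearClique G x Q ↔ G.Adj x z ∧ #{v ∈ Q | ¬ G.Adj z v} ≤ 6 := by
  simp [nearClique]

lemma isClique_insert_nearClique (h : G.IsSRGWith 1911 270 105 27) (x : V) {Q : Finset V}
    (hc : 58 ≤ #Q) : G.IsClique ((insert x (nearClique G x Q) : Finset V) : Set V) := by
  refine isClique_insert_nbr (fun u hu v hv huv => ?_) fun v hv => (mem_nearClique.mp hv).1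
  exact adj_of_card_nonadj h hc (mem_nearClique.mp hu).2 (mem_nearClique.mp hv).2 huv

lemma self_notMem_nearClique (x : V) (Q : Finset V) : x ∉ nearClique G x Q := fun hx =>
  G.loopless.irrefl _ (mem_nearClique.mp hx).1

lemma card_nearClique_le (h : G.IsSRGWith 1911 270 105 27) (x : V) {Q : Finset V}
    (hc : 58 ≤ #Q) : #(nearClique G x Q) ≤ 90 := by
  have := card_clique_le h (isClique_insert_nearClique h x hc)
  rw [card_insert_of_notMem (self_notMem_nearClique x Q)] at this
  omega

/-- The neighbourhood of `x` is covered by three cliques. -/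
lemma nbr_subset_nearClique (h : G.IsSRGWith 1911 270 105 27) {x p q r : V} (hp : G.Adj x p)
    (hq : G.Adj x q) (hr : G.Adj x r) (hpq : p ≠ q ∧ ¬ G.Adj p q) (hpr : p ≠ r ∧ ¬ G.Adj p r)
    (hqr : q ≠ r ∧ ¬ G.Adj q r) :
    ({v | G.Adj x v} : Finset V) ⊆ nearClique G x (farNbrs G x q r) ∪
      (nearClique G x (farNbrs G x p r) ∪ nearClique G x (farNbrs G x p q)) := by
  intro z hz
  simp only [mem_filter, mem_univ, true_and] at hz
  by_contra hn
  simp only [mem_union, mem_nearClique, hz, true_and, not_or] at hn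
  obtain ⟨hn1, hn2, hn3⟩ := hn
  have c1 := le_card_farNbrs h hq hr
  have c2 := le_card_farNbrs h hp hr
  have c3 := le_card_farNbrs h hp hq
  have k1 := isClique_farNbrs h hq hr hqr
  have k2 := isClique_farNbrs h hp hr hpr
  have k3 := isClique_farNbrs h hp hq hpq
  have m1 : ∀ v ∈ farNbrs G x q r, G.Adj x v := fun v hv => (mem_farNbrs.mp hv).1
  have m2 : ∀ v ∈ farNbrs G x p r, G.Adj x v := fun v hv => (mem_farNbrs.mp hv).1
  have m3 : ∀ v ∈ farNbrs G x p q, G.Adj x v := fun v hv => (mem_farNbrs.mp hv).1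
  have z1 := (card_adj_le_or h k1 m1 c1 hz).resolve_right hn1
  have z2 := (card_adj_le_or h k2 m2 c2 hz).resolve_right hn2
  have z3 := (card_adj_le_or h k3 m3 c3 hz).resolve_right hn3
  have symm : ∀ {u v : V}, (u ≠ v ∧ ¬ G.Adj u v) → (v ≠ u ∧ ¬ G.Adj v u) := fun hh =>
    ⟨hh.1.symm, fun e => hh.2 e.symm⟩
  have hqQ : q ∈ farNbrs G x p r := mem_farNbrs.mpr ⟨hq, hpq, symm hqr⟩
  have hrQ : r ∈ farNbrs G x p q := mem_farNbrs.mpr ⟨hr, hpr, hqr⟩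
  obtain ⟨a, ha, ha'⟩ : ∃ a ∈ farNbrs G x q r,
      a ∉ {v ∈ farNbrs G x q r | G.Adj z v} ∪ {z} := by
    apply exists_mem_notMem_of_card_lt_card
    exact (card_union_le _ _).trans_lt (by rw [card_singleton]; omega)
  simp only [mem_union, mem_filter, ha, true_and, mem_singleton, not_or] at ha'
  obtain ⟨-, -, hra⟩ := mem_farNbrs.mp ha
  obtain ⟨-, hqa, -⟩ := mem_farNbrs.mp ha
  have a2 := card_adj_le_five h k2 m2 c2 (m1 a ha) hqQ (symm hqa)
  have a3 := card_adj_le_five h k3 m3 c3 (m1 a ha) hrQ (symm hra)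
  obtain ⟨b, hb, hb'⟩ : ∃ b ∈ farNbrs G x p r,
      b ∉ {v ∈ farNbrs G x p r | G.Adj z v} ∪
        ({v ∈ farNbrs G x p r | G.Adj a v} ∪ {z, a}) := by
    apply exists_mem_notMem_of_card_lt_card
    have := card_le_two (a := z) (b := a)
    exact ((card_union_le _ _).trans (Nat.add_le_add_left (card_union_le _ _) _)).trans_lt
      (by omega)
  simp only [mem_union, mem_filter, hb, true_and, mem_singleton, mem_insert, not_or] at hb'
  obtain ⟨-, -, hrb⟩ := mem_farNbrs.mp hb
  have b3 := card_adj_le_five h k3 m3 c3 (m2 b hb) hrQ (symm hrb)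
  obtain ⟨d, hd, hd'⟩ : ∃ d ∈ farNbrs G x p q,
      d ∉ {v ∈ farNbrs G x p q | G.Adj z v} ∪ ({v ∈ farNbrs G x p q | G.Adj a v} ∪
        ({v ∈ farNbrs G x p q | G.Adj b v} ∪ {z, a, b})) := by
    apply exists_mem_notMem_of_card_lt_card
    have := card_le_three (a := z) (b := a) (c := b)
    exact ((card_union_le _ _).trans (Nat.add_le_add_left ((card_union_le _ _).trans
      (Nat.add_le_add_left (card_union_le _ _) _)) _)).trans_lt (by omega)
  simp only [mem_union, mem_filter, hd, true_and, mem_singleton, mem_insert, not_or] at hd'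
  exact not_isClaw h x z a b d ⟨hz, m1 a ha, m2 b hb, m3 d hd, ⟨Ne.symm ha'.2, ha'.1⟩,
    ⟨Ne.symm hb'.2.2.1, hb'.1⟩, ⟨Ne.symm hd'.2.2.2.1, hd'.1⟩, ⟨Ne.symm hb'.2.2.2, hb'.2.1⟩,
    ⟨Ne.symm hd'.2.2.2.2.1, hd'.2.1⟩, ⟨Ne.symm hd'.2.2.2.2.2, hd'.2.2.1⟩⟩

/-- Each vertex lies on three cliques of size `91` which cover its neighbourhood and pairwise
meet only in that vertex. -/
lemma exists_lines (h : G.IsSRGWith 1911 270 105 27) (x : V) :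
    ∃ L : Fin 3 → Finset V, (∀ i, x ∈ L i ∧ G.IsClique (L i : Set V) ∧ #(L i) = 91) ∧
      (∀ z, G.Adj x z → ∃ i, z ∈ L i) ∧
      ∀ i j, ∀ z, z ∈ L i → z ∈ L j → z ≠ x → i = j := by
  obtain ⟨p, q, r, hp, hq, hr, hpq, hpr, hqr⟩ := exists_triple h x
  have c1 := le_card_farNbrs h hq hr
  have c2 := le_card_farNbrs h hp hr
  have c3 := le_card_farNbrs h hp hq
  have hsub := nbr_subset_nearClique h hp hq hr hpq hpr hqr
  have hcard := card_le_card hsub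
  rw [card_nbr h] at hcard
  let Q : Fin 3 → Finset V := ![farNbrs G x q r, farNbrs G x p r, farNbrs G x p q]
  have hQ : ∀ i, 58 ≤ #(Q i) := by
    intro i; fin_cases i
    exacts [c1, c2, c3]
  have hle : ∀ i, #(nearClique G x (Q i)) ≤ 90 := fun i => card_nearClique_le h x (hQ i)
  have hM : ∀ i, #(nearClique G x (Q i)) = 90 ∧
      ∀ j, ∀ z, z ∈ nearClique G x (Q i) → z ∈ nearClique G x (Q j) → i = j := by
    have e1 := hle 0
    have e2 := hle 1
    have e3 := hle 2
    change 270 ≤ #(nearClique G x (Q 0) ∪ (nearClique G x (Q 1) ∪ nearClique G x (Q 2))) at hcard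
    have u1 := card_union_add_card_inter (nearClique G x (Q 0))
      (nearClique G x (Q 1) ∪ nearClique G x (Q 2))
    have u2 := card_union_add_card_inter (nearClique G x (Q 1)) (nearClique G x (Q 2))
    have d1 : nearClique G x (Q 0) ∩ (nearClique G x (Q 1) ∪ nearClique G x (Q 2)) = ∅ := by
      rw [← card_eq_zero]; omega
    have d2 : nearClique G x (Q 1) ∩ nearClique G x (Q 2) = ∅ := by
      rw [← card_eq_zero]; omega
    have f1 : ∀ z, z ∈ nearClique G x (Q 0) → z ∈ nearClique G x (Q 1) → False := fun z h1 h2 =>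
      notMem_empty z (d1 ▸ mem_inter.mpr ⟨h1, mem_union_left _ h2⟩)
    have f2 : ∀ z, z ∈ nearClique G x (Q 0) → z ∈ nearClique G x (Q 2) → False := fun z h1 h2 =>
      notMem_empty z (d1 ▸ mem_inter.mpr ⟨h1, mem_union_right _ h2⟩)
    have f3 : ∀ z, z ∈ nearClique G x (Q 1) → z ∈ nearClique G x (Q 2) → False := fun z h1 h2 =>
      notMem_empty z (d2 ▸ mem_inter.mpr ⟨h1, h2⟩)
    intro i
    refine ⟨by fin_cases i <;> simp only [Fin.zero_eta, Fin.mk_one, Fin.reduceFinMk] <;> omega,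
      fun j z h1 h2 => ?_⟩
    fin_cases i <;> fin_cases j <;> first
      | rfl
      | exact (f1 z h1 h2).elim
      | exact (f1 z h2 h1).elim
      | exact (f2 z h1 h2).elim
      | exact (f2 z h2 h1).elim
      | exact (f3 z h1 h2).elim
      | exact (f3 z h2 h1).elim
  refine ⟨fun i => insert x (nearClique G x (Q i)), fun i => ⟨mem_insert_self _ _,
    isClique_insert_nearClique h x (hQ i), ?_⟩, fun z hz => ?_, fun i j z hi hj hzx => ?_⟩
  · rw [card_insert_of_notMem (self_notMem_nearClique x _), (hM i).1]
  · have := hsub (by simpa using hz : z ∈ ({v | G.Adj x v} : Finset V))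
    simp only [mem_union] at this
    rcases this with h1 | h1 | h1
    exacts [⟨0, mem_insert_of_mem h1⟩, ⟨1, mem_insert_of_mem h1⟩, ⟨2, mem_insert_of_mem h1⟩]
  · exact (hM i).2 j z (mem_of_mem_insert_of_ne hi hzx) (mem_of_mem_insert_of_ne hj hzx)

lemma exists_card_inter_ge {L : Fin 3 → Finset V} {S : Finset V} {n : ℕ} (hS : 3 * n ≤ #S)
    (hL : ∀ v ∈ S, ∃ i, v ∈ L i) : ∃ i, n ≤ #(S ∩ L i) := by
  by_contra! hlt
  have h1 : S ⊆ univ.biUnion fun i => S ∩ L i := by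
    intro v hv
    obtain ⟨i, hi⟩ := hL v hv
    exact mem_biUnion.mpr ⟨i, mem_univ _, mem_inter.mpr ⟨hv, hi⟩⟩
  have h2 := (card_le_card h1).trans card_biUnion_le
  rw [Fin.sum_univ_three] at h2
  have := hlt 0
  have := hlt 1
  have := hlt 2
  omega

lemma eq_line (h : G.IsSRGWith 1911 270 105 27) {u : V} {N : Fin 3 → Finset V}
    (hN : ∀ i, u ∈ N i ∧ G.IsClique (N i : Set V) ∧ #(N i) = 91)
    (hcov : ∀ z, G.Adj u z → ∃ i, z ∈ N i) {L : Finset V} (hL : G.IsClique (L : Set V))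
    (hc : #L = 91) (hu : u ∈ L) : ∃ i, L = N i := by
  obtain ⟨i, hi⟩ := exists_card_inter_ge (n := 30) (S := L.erase u) (L := N)
    (by rw [card_erase_of_mem hu, hc]) fun v hv =>
      hcov v (hL hu (mem_of_mem_erase hv) (ne_of_mem_erase hv).symm)
  refine ⟨i, eq_of_subset_of_card_le (fun w hw => ?_) (by rw [hc, (hN i).2.2])⟩
  by_contra hwN
  have h1 := card_adj_of_card_eq h (hN i).2.1 (hN i).2.2 hwN
  have h2 : #(L.erase u ∩ N i) ≤ #{v ∈ N i | G.Adj w v} := by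
    refine card_le_card fun v hv => ?_
    obtain ⟨hv1, hv2⟩ := mem_inter.mp hv
    refine mem_filter.mpr ⟨hv2, hL hw (mem_of_mem_erase hv1) ?_⟩
    rintro rfl
    exact hwN hv2
  omega

/-- Cliques of size `91` sharing an edge coincide. -/
lemma clique_eq_of_mem (h : G.IsSRGWith 1911 270 105 27) {L L' : Finset V}
    (hL : G.IsClique (L : Set V)) (hc : #L = 91) (hL' : G.IsClique (L' : Set V))
    (hc' : #L' = 91) {u v : V} (huv : v ≠ u) (hu : u ∈ L) (hu' : u ∈ L') (hv : v ∈ L)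
    (hv' : v ∈ L') : L = L' := by
  obtain ⟨N, hN, hcov, hdis⟩ := exists_lines h u
  obtain ⟨i, rfl⟩ := eq_line h hN hcov hL hc hu
  obtain ⟨j, rfl⟩ := eq_line h hN hcov hL' hc' hu'
  rw [hdis i j v hv hv' huv]

lemma not_isSRGWith (h : G.IsSRGWith 1911 270 105 27) : False := by
  have : Nonempty V := Fintype.card_pos_iff.mp (by rw [h.card]; norm_num)
  obtain ⟨x⟩ := this
  obtain ⟨L, hL, -, hdis⟩ := exists_lines h x
  obtain ⟨z, hz, hzx⟩ := exists_mem_ne (s := L 0) (by rw [(hL 0).2.2]; norm_num) x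
  have hz1 : z ∉ L 1 := fun hz1 => absurd (hdis 0 1 z hz hz1 hzx) (by decide)
  obtain ⟨N, hN, hcov, -⟩ := exists_lines h z
  obtain ⟨i, hi⟩ := exists_card_inter_ge (n := 3) (S := {v ∈ L 1 | G.Adj z v}) (L := N)
    (by rw [card_adj_of_card_eq h (hL 1).2.1 (hL 1).2.2 hz1]) fun v hv =>
      hcov v (mem_filter.mp hv).2
  obtain ⟨u, hu, v, hv, huv⟩ := one_lt_card.mp (lt_of_lt_of_le (by norm_num) hi)
  simp only [mem_inter, mem_filter] at hu hv
  apply hz1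
  rw [clique_eq_of_mem h (hL 1).2.1 (hL 1).2.2 (hN i).2.1 (hN i).2.2 huv.symm hu.1.1 hu.2
    hv.1.1 hv.2]
  exact (hN i).1

end

/-- There does not exist a strongly regular graph with parameters
`(1911, 270, 105, 27)`. -/
theorem no_srg_1911_270_105_27 (V : Type*) [Fintype V] (G : SimpleGraph V)
    [DecidableRel G.Adj] : ¬ G.IsSRGWith 1911 270 105 27 := by
  classical
  exact fun h => not_isSRGWith h
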